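/- Let V and C be finite nonempty types, let wvec : V → ℝ^d and cvec : C → ℝ^d be word and context vectors, let P : V × C → ℝ be a joint probability mass function (P ≥ 0, ∑_{(w,c)} P(w,c) = 1) with marginals p_V(w) := ∑_c P(w,c) and p_C(c) := ∑_w P(w,c), and let k > 0. Suppose the Levy–Goldberg formula holds: for all w, c, P(w,c) = k * p_V(w) * p_C(c) * exp⟨wvec w, cvec c⟩. Then for every c with p_C(c) > 0, the Zipfian partition function is constant: ∑_w p_V(w) * exp⟨wvec w, cvec c⟩ = 1/k. -/

import Mathlib

open Finset Matrix

theorem levy_goldberg_constant_partition {V C : Type*} [Fintype V] [Fintype C]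
    [Nonempty V] [Nonempty C] {d : ℕ}
    (wvec : V → Fin d → ℝ) (cvec : C → Fin d → ℝ)
    (P : V × C → ℝ)
    (hP_nonneg : ∀ x, 0 ≤ P x) (hP_sum : ∑ x, P x = 1)
    (k : ℝ) (hk : 0 < k)
    (hLG : ∀ w c, P (w, c) =
      k * (∑ c', P (w, c')) * (∑ w', P (w', c)) * Real.exp (wvec w ⬝ᵥ cvec c)) :
    ∀ c, 0 < ∑ w', P (w', c) →
      ∑ w, (∑ c', P (w, c')) * Real.exp (wvec w ⬝ᵥ cvec c) = 1 / k := by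
  intro c hc
  have h : ∑ w', P (w', c) = (∑ w', P (w', c)) *
      (k * ∑ w, (∑ c', P (w, c')) * Real.exp (wvec w ⬝ᵥ cvec c)) := by
    conv_lhs => rw [Finset.sum_congr rfl fun w _ => hLG w c]
    simp only [Finset.mul_sum (s := (univ : Finset V)) (a := k)]
    rw [Finset.mul_sum]
    exact Finset.sum_congr rfl fun w _ => by ring
  rw [eq_div_iff hk.ne', mul_comm]
  exact (mul_eq_left₀ hc.ne').mp h.symm
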